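/- Let f : X → ℝ^M be any function such that for every r ∈ X one has 0 ≤ f(r) ≤ 1 componentwise and Γ_r(f(r)) = f(r). Then f is Lipschitz continuous on X: there exists L ≥ 0 such that ‖f(r) − f(r')‖ ≤ L ‖r − r'‖ (Euclidean norms) for all r, r' ∈ X. -/

import Mathlib

open Finset

/-- SINR of the link from base station `i` to test point `j`, given load vector `ρ`. -/
noncomputable def gamma (M N : ℕ) (p : Fin M → ℝ) (G : Fin M → Fin N → ℝ) (s2 : ℝ)
    (ρ : Fin M → ℝ) (i : Fin M) (j : Fin N) : ℝ :=
  p i * G i j / ((∑ k ∈ Finset.univ.erase i, p k * G k j * ρ k) + s2)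

/-- The load mapping `q(ρ, r)`; `serv j` is the (unique) base station serving test point `j`,
so that `N(i) = {j | serv j = i}`. -/
noncomputable def loadMap (M N : ℕ) (p : Fin M → ℝ) (G : Fin M → Fin N → ℝ) (s2 c : ℝ)
    (serv : Fin N → Fin M) (ρ : Fin M → ℝ) (r : Fin N → ℝ) : Fin M → ℝ :=
  fun i => (1 / c) * ∑ j ∈ Finset.univ.filter (fun j => serv j = i),
    r j / Real.log (1 + gamma M N p G s2 ρ i j)

/-- A rate vector `r > 0` is feasible if the load mapping `Γ_r` has a fixed point `ρ*`
with `0 ≤ ρ* ≤ 1` componentwise. -/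
def Feasible (M N : ℕ) (p : Fin M → ℝ) (G : Fin M → Fin N → ℝ) (s2 c : ℝ)
    (serv : Fin N → Fin M) (r : Fin N → ℝ) : Prop :=
  ∃ ρ : Fin M → ℝ, (∀ i, 0 ≤ ρ i) ∧ (∀ i, ρ i ≤ 1) ∧ loadMap M N p G s2 c serv ρ r = ρ

/-- The feasible rate region `X`. -/
def FeasRegion (M N : ℕ) (p : Fin M → ℝ) (G : Fin M → Fin N → ℝ) (s2 c : ℝ)
    (serv : Fin N → Fin M) (rmin : Fin N → ℝ) : Set (Fin N → ℝ) :=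
  {r | (∀ j, 0 < r j) ∧ (∀ j, rmin j ≤ r j) ∧ Feasible M N p G s2 c serv r}

/-- Euclidean norm of a finitely-indexed real vector. -/
noncomputable def euclNorm {n : ℕ} (x : Fin n → ℝ) : ℝ :=
  Real.sqrt (∑ i, x i ^ 2)

/-- The map `x ↦ 1 / log (1 + a / x)` is subhomogeneous and increasing. -/
lemma log_one_add_div_le_mul_log {a x y s : ℝ} (ha : 0 ≤ a) (hx : 0 < x) (hy : 0 < y)
    (hs : 1 ≤ s) (hyx : y ≤ s * x) :
    Real.log (1 + a / x) ≤ s * Real.log (1 + a / y) := by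
  have hs0 : 0 < s := by linarith
  have hay : 0 ≤ a / y := by positivity
  rw [← Real.log_rpow (by positivity)]
  refine Real.log_le_log (by positivity)
    (le_trans ?_ (one_add_mul_self_le_rpow_one_add (by linarith) hs))
  gcongr
  rw [← mul_div_assoc, div_le_div_iff₀ hx hy]
  nlinarith [mul_le_mul_of_nonneg_left hyx ha]

section LoadMap

variable {M N : ℕ} {p : Fin M → ℝ} {G : Fin M → Fin N → ℝ} {s2 c : ℝ} {serv : Fin N → Fin M}

lemma interference_nonneg (hp : ∀ i, 0 < p i) (hG : ∀ k j, 0 ≤ G k j) {ρ : Fin M → ℝ}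
    (hρ : ∀ i, 0 ≤ ρ i) (i : Fin M) (j : Fin N) :
    0 ≤ ∑ k ∈ Finset.univ.erase i, p k * G k j * ρ k :=
  Finset.sum_nonneg fun k _ => mul_nonneg (mul_nonneg (hp k).le (hG k j)) (hρ k)

lemma interference_le (hp : ∀ i, 0 < p i) (hG : ∀ k j, 0 ≤ G k j) {ρ : Fin M → ℝ}
    (hρ1 : ∀ i, ρ i ≤ 1) (i : Fin M) (j : Fin N) :
    ∑ k ∈ Finset.univ.erase i, p k * G k j * ρ k ≤ ∑ l, ∑ k, p k * G k l := by
  have hpG : ∀ k l, 0 ≤ p k * G k l := fun k l => mul_nonneg (hp k).le (hG k l)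
  calc ∑ k ∈ Finset.univ.erase i, p k * G k j * ρ k
      ≤ ∑ k ∈ Finset.univ.erase i, p k * G k j :=
        Finset.sum_le_sum fun k _ => mul_le_of_le_one_right (hpG k j) (hρ1 k)
    _ ≤ ∑ k, p k * G k j :=
        Finset.sum_le_sum_of_subset_of_nonneg (Finset.erase_subset _ _) fun k _ _ => hpG k j
    _ ≤ ∑ l, ∑ k, p k * G k l :=
        Finset.single_le_sum (f := fun l => ∑ k, p k * G k l)
          (fun l _ => Finset.sum_nonneg fun k _ => hpG k l) (Finset.mem_univ j)

lemma gamma_pos (hp : ∀ i, 0 < p i) (hG : ∀ k j, 0 ≤ G k j) (hs2 : 0 < s2) {ρ : Fin M → ℝ}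
    (hρ : ∀ i, 0 ≤ ρ i) {i : Fin M} {j : Fin N} (hij : 0 < G i j) :
    0 < gamma M N p G s2 ρ i j :=
  div_pos (mul_pos (hp i) hij) (by linarith [interference_nonneg hp hG hρ i j])

lemma log_one_add_gamma_pos (hp : ∀ i, 0 < p i) (hG : ∀ k j, 0 ≤ G k j) (hs2 : 0 < s2)
    {ρ : Fin M → ℝ} (hρ : ∀ i, 0 ≤ ρ i) {i : Fin M} {j : Fin N} (hij : 0 < G i j) :
    0 < Real.log (1 + gamma M N p G s2 ρ i j) :=
  Real.log_pos (by linarith [gamma_pos hp hG hs2 hρ hij])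

/-- Scaling the loads by `1 + t` scales the load mapping by at most `1 + t * η`, where `η < 1`
bounds the share of the interference in interference plus noise. -/
lemma loadMap_le_of_le_mul (hp : ∀ i, 0 < p i) (hG : ∀ k j, 0 ≤ G k j) (hs2 : 0 < s2)
    (hc : 0 < c) (hserv : ∀ j, 0 < G (serv j) j) {B : ℝ}
    (hB : B = ∑ l, ∑ k, p k * G k l) {ρ ρ' : Fin M → ℝ} (hρ : ∀ i, 0 ≤ ρ i)
    (hρ' : ∀ i, 0 ≤ ρ' i) (hρ'1 : ∀ i, ρ' i ≤ 1) {t : ℝ} (ht : 0 ≤ t)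
    (h : ∀ i, ρ i ≤ (1 + t) * ρ' i) {r : Fin N → ℝ} (hr : ∀ j, 0 < r j) (i : Fin M) :
    loadMap M N p G s2 c serv ρ r i
      ≤ (1 + t * (B / (B + s2))) * loadMap M N p G s2 c serv ρ' r i := by
  unfold loadMap
  rw [mul_left_comm, Finset.mul_sum _ _ (1 + t * (B / (B + s2)))]
  refine mul_le_mul_of_nonneg_left (Finset.sum_le_sum fun j hj => ?_) (by positivity)
  obtain rfl : serv j = i := by simpa using hj
  have hlog := log_one_add_gamma_pos hp hG hs2 hρ (hserv j)
  have hlog' := log_one_add_gamma_pos hp hG hs2 hρ' (hserv j)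
  have hI := interference_nonneg hp hG hρ (serv j) j
  have hI' := interference_nonneg hp hG hρ' (serv j) j
  have hI'B := interference_le hp hG hρ'1 (serv j) j
  rw [← hB] at hI'B
  have hB0 : 0 ≤ B := hI'.trans hI'B
  have hII' : ∑ k ∈ Finset.univ.erase (serv j), p k * G k j * ρ k
      ≤ (1 + t) * ∑ k ∈ Finset.univ.erase (serv j), p k * G k j * ρ' k := by
    rw [Finset.mul_sum]
    refine Finset.sum_le_sum fun k _ => ?_
    rw [mul_left_comm]
    exact mul_le_mul_of_nonneg_left (h k) (mul_nonneg (hp k).le (hG k j))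
  have key : Real.log (1 + gamma M N p G s2 ρ' (serv j) j)
      ≤ (1 + t * (B / (B + s2))) * Real.log (1 + gamma M N p G s2 ρ (serv j) j) := by
    refine log_one_add_div_le_mul_log (mul_nonneg (hp _).le (hG _ _)) (by linarith)
      (by linarith) (le_add_of_nonneg_right (by positivity)) ?_
    set I' := ∑ k ∈ Finset.univ.erase (serv j), p k * G k j * ρ' k
    have hη : I' ≤ B / (B + s2) * (I' + s2) := by
      rw [div_mul_eq_mul_div, le_div_iff₀ (by positivity)]
      nlinarith
    nlinarith [mul_le_mul_of_nonneg_left hη ht]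
  rw [← mul_div_assoc, div_le_div_iff₀ hlog hlog']
  nlinarith [mul_le_mul_of_nonneg_left key (hr j).le]

/-- A relative perturbation of the rates gives a relative perturbation of the loads. -/
lemma loadMap_le_add_of_sub_le (hp : ∀ i, 0 < p i) (hG : ∀ k j, 0 ≤ G k j) (hs2 : 0 < s2)
    (hc : 0 < c) (hserv : ∀ j, 0 < G (serv j) j) {ρ : Fin M → ℝ} (hρ : ∀ i, 0 ≤ ρ i)
    {μ : ℝ} {r r' : Fin N → ℝ} (h : ∀ j, r j - r' j ≤ μ * r j) (i : Fin M) :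
    loadMap M N p G s2 c serv ρ r i
      ≤ loadMap M N p G s2 c serv ρ r' i + μ * loadMap M N p G s2 c serv ρ r i := by
  unfold loadMap
  rw [mul_left_comm μ, Finset.mul_sum _ _ μ, ← mul_add, ← Finset.sum_add_distrib]
  refine mul_le_mul_of_nonneg_left (Finset.sum_le_sum fun j hj => ?_) (by positivity)
  obtain rfl : serv j = i := by simpa using hj
  rw [← mul_div_assoc, ← add_div]
  exact div_le_div_of_nonneg_right (by linarith [h j])
    (log_one_add_gamma_pos hp hG hs2 hρ (hserv j)).le

/-- The load of a base station is bounded below by the interference-free load caused by any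
test point it serves. -/
lemma le_loadMap (hp : ∀ i, 0 < p i) (hG : ∀ k j, 0 ≤ G k j) (hs2 : 0 < s2)
    (hc : 0 < c) (hserv : ∀ j, 0 < G (serv j) j) {ρ : Fin M → ℝ} (hρ : ∀ i, 0 ≤ ρ i)
    {r : Fin N → ℝ} (hr : ∀ j, 0 < r j) (j : Fin N) :
    1 / c * (r j * s2 / (p (serv j) * G (serv j) j))
      ≤ loadMap M N p G s2 c serv ρ r (serv j) := by
  unfold loadMap
  have hlog := fun l => log_one_add_gamma_pos hp hG hs2 hρ (hserv l)
  refine mul_le_mul_of_nonneg_left ?_ (by positivity)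
  refine le_trans ?_ (Finset.single_le_sum
    (f := fun l => r l / Real.log (1 + gamma M N p G s2 ρ (serv j) l))
    (fun l hl => ?_) (show j ∈ Finset.univ.filter (fun l => serv l = serv j) by simp))
  · have hA : 0 < p (serv j) * G (serv j) j := mul_pos (hp _) (hserv j)
    have hγ : gamma M N p G s2 ρ (serv j) j ≤ p (serv j) * G (serv j) j / s2 :=
      div_le_div_of_nonneg_left hA.le hs2
        (by linarith [interference_nonneg hp hG hρ (serv j) j])
    have hlogle : Real.log (1 + gamma M N p G s2 ρ (serv j) j)
        ≤ p (serv j) * G (serv j) j / s2 := by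
      have := Real.log_le_sub_one_of_pos
        (show 0 < 1 + gamma M N p G s2 ρ (serv j) j by
          linarith [gamma_pos hp hG hs2 hρ (hserv j)])
      linarith
    calc r j * s2 / (p (serv j) * G (serv j) j)
        = r j / (p (serv j) * G (serv j) j / s2) := by field_simp
      _ ≤ r j / Real.log (1 + gamma M N p G s2 ρ (serv j) j) :=
        div_le_div_of_nonneg_left (hr j).le (hlog j) hlogle
  · have hl' : serv l = serv j := by simpa using hl
    have := hlog l
    rw [hl'] at this
    exact (div_pos (hr l) this).le

end LoadMap

/-- If every bound `ρ ≤ (1 + t) ρ'` improves to `ρ ≤ (1 + t η + ε) ρ'` with `η < 1`, then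
`ρ ≤ (1 + ε / (1 - η)) ρ'`. -/
lemma le_mul_of_improving_bound {ι : Type*} [Fintype ι] {ρ ρ' : ι → ℝ}
    (hρ' : ∀ i, 0 ≤ ρ' i) (hzero : ∀ i, ρ' i = 0 → ρ i = 0) {η ε : ℝ} (hη : η < 1) (hε : 0 ≤ ε)
    (himp : ∀ t, 0 ≤ t → (∀ i, ρ i ≤ (1 + t) * ρ' i) → ∀ i, ρ i ≤ (1 + t * η + ε) * ρ' i)
    (i : ι) : ρ i ≤ (1 + ε / (1 - η)) * ρ' i := by
  have hη' : 0 < 1 - η := by linarith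
  have : Nonempty ι := ⟨i⟩
  obtain ⟨m, -, hm⟩ := Finset.exists_max_image Finset.univ (fun k => ρ k / ρ' k)
    Finset.univ_nonempty
  have hle : ∀ k, ∀ s, ρ m / ρ' m ≤ s → ρ k ≤ s * ρ' k := fun k s hs => by
    rcases (hρ' k).eq_or_lt with h0 | h0
    · simp [hzero k h0.symm, ← h0]
    · exact (div_le_iff₀ h0).1 ((hm k (Finset.mem_univ k)).trans hs)
  refine hle i _ ?_
  by_contra! hlt
  have hε' : 0 ≤ ε / (1 - η) := by positivity
  have hm0 : 0 < ρ' m := (hρ' m).lt_of_ne fun h0 => by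
    rw [← h0, div_zero] at hlt
    linarith
  have h1 := himp (ρ m / ρ' m - 1) (by linarith) (fun k => hle k _ (by linarith)) m
  rw [← div_le_iff₀ hm0] at h1
  have h2 : ε / (1 - η) < ρ m / ρ' m - 1 := by linarith
  rw [div_lt_iff₀ hη'] at h2
  nlinarith

lemma euclNorm_nonneg {n : ℕ} (x : Fin n → ℝ) : 0 ≤ euclNorm x := Real.sqrt_nonneg _

lemma abs_le_euclNorm {n : ℕ} (x : Fin n → ℝ) (i : Fin n) : |x i| ≤ euclNorm x :=
  Real.abs_le_sqrt
    (Finset.single_le_sum (f := fun i => x i ^ 2) (fun _ _ => sq_nonneg _) (Finset.mem_univ i))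

lemma euclNorm_le_of_abs_le {n : ℕ} {x : Fin n → ℝ} {b : ℝ} (hb : 0 ≤ b)
    (h : ∀ i, |x i| ≤ b) : euclNorm x ≤ √n * b := by
  refine (Real.sqrt_le_sqrt (Finset.sum_le_sum fun i _ => sq_le_sq' (abs_le.1 (h i)).1
    (abs_le.1 (h i)).2)).trans_eq ?_
  simp [Real.sqrt_sq hb]

/-- Any map sending each feasible rate vector to a fixed point of the
associated load mapping (with values in `[0,1]^M`) is Lipschitz continuous on `X`
with respect to the Euclidean norms. -/
theorem fixedPoint_map_lipschitzOn
    {M N : ℕ} (hM : 0 < M) (hN : 0 < N)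
    (p : Fin M → ℝ) (hp : ∀ i, 0 < p i)
    (G : Fin M → Fin N → ℝ) (hG : ∀ k j, 0 ≤ G k j)
    (s2 : ℝ) (hs2 : 0 < s2) (c : ℝ) (hc : 0 < c)
    (serv : Fin N → Fin M) (hserv : ∀ j, 0 < G (serv j) j)
    (rmin : Fin N → ℝ) (hrmin : ∀ j, 0 < rmin j)
    (hXne : (FeasRegion M N p G s2 c serv rmin).Nonempty)
    (f : (Fin N → ℝ) → (Fin M → ℝ))
    (hf : ∀ r ∈ FeasRegion M N p G s2 c serv rmin,
      (∀ i, 0 ≤ f r i) ∧ (∀ i, f r i ≤ 1) ∧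
      loadMap M N p G s2 c serv (f r) r = f r) :
    ∃ L : ℝ, 0 ≤ L ∧ ∀ r ∈ FeasRegion M N p G s2 c serv rmin,
      ∀ r' ∈ FeasRegion M N p G s2 c serv rmin,
        euclNorm (f r - f r') ≤ L * euclNorm (r - r') := by
  have : Nonempty (Fin N) := ⟨⟨0, hN⟩⟩
  obtain ⟨a, ha⟩ := Finite.exists_min rmin
  obtain ⟨b, hb⟩ := Finite.exists_min
    fun j => 1 / c * (rmin j * s2 / (p (serv j) * G (serv j) j))
  set m := 1 / c * (rmin b * s2 / (p (serv b) * G (serv b) b))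
  have hm0 : 0 < m := by
    have := hrmin b
    have := hp (serv b)
    have := hserv b
    positivity
  have ha0 := hrmin a
  set B := ∑ l, ∑ k, p k * G k l with hB
  have hB0 : 0 ≤ B :=
    Finset.sum_nonneg fun l _ => Finset.sum_nonneg fun k _ => mul_nonneg (hp k).le (hG k l)
  have hη : B / (B + s2) < 1 := by
    rw [div_lt_one (by linarith)]
    linarith
  have hη' : 0 < 1 - B / (B + s2) := by linarith
  have onesided : ∀ r ∈ FeasRegion M N p G s2 c serv rmin,
      ∀ r' ∈ FeasRegion M N p G s2 c serv rmin, ∀ d, 0 ≤ d → (∀ j, r j - r' j ≤ d) →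
      ∀ i, f r i - f r' i ≤ d / rmin a / m / (1 - B / (B + s2)) := by
    intro r hr r' hr' d hd hrd i
    obtain ⟨h0, h1, hfix⟩ := hf r hr
    obtain ⟨h0', h1', hfix'⟩ := hf r' hr'
    have hfixi : ∀ i, loadMap M N p G s2 c serv (f r) r i = f r i := congrFun hfix
    have hfixi' : ∀ i, loadMap M N p G s2 c serv (f r') r' i = f r' i := congrFun hfix'
    have hidle : ∀ i, (f r i = 0) ∨ m ≤ f r' i := by
      intro i
      by_cases hi : ∃ j, serv j = i
      · obtain ⟨j, rfl⟩ := hi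
        right
        rw [← hfixi']
        refine ((hb j).trans ?_).trans (le_loadMap hp hG hs2 hc hserv h0' hr'.1 j)
        have := mul_pos (hp (serv j)) (hserv j)
        have := hr'.2.1 j
        gcongr
      · left
        rw [← hfixi]
        push Not at hi
        simp [loadMap, Finset.filter_false_of_mem fun j _ => hi j]
    have hbound := le_mul_of_improving_bound (ρ := f r) (ρ' := f r') h0'
      (fun k hk => (hidle k).resolve_right (by linarith)) hη
      (ε := d / rmin a / m) (by positivity) (fun t ht hle k => by
        rcases hidle k with hk | hk
        · rw [hk]
          have := h0' k
          positivity
        · have hrate := loadMap_le_add_of_sub_le (μ := d / rmin a) hp hG hs2 hc hserv h0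
            (fun j => (hrd j).trans (by
              rw [div_mul_eq_mul_div, le_div_iff₀ ha0]
              exact mul_le_mul_of_nonneg_left ((ha j).trans (hr.2.1 j)) hd)) k
          have hscale := loadMap_le_of_le_mul hp hG hs2 hc hserv hB h0 h0' h1' ht hle hr'.1 k
          rw [hfixi] at hrate
          rw [hfixi'] at hscale
          have hμ : d / rmin a * f r k ≤ d / rmin a / m * f r' k := by
            calc d / rmin a * f r k ≤ d / rmin a * 1 :=
                  mul_le_mul_of_nonneg_left (h1 k) (by positivity)
              _ = d / rmin a / m * m := by field_simp
              _ ≤ d / rmin a / m * f r' k := mul_le_mul_of_nonneg_left hk (by positivity)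
          linarith) i
    have hε : 0 ≤ d / rmin a / m / (1 - B / (B + s2)) := by positivity
    nlinarith [mul_le_mul_of_nonneg_left (h1' i) hε]
  refine ⟨√M * (1 / rmin a / m / (1 - B / (B + s2))), by positivity, fun r hr r' hr' => ?_⟩
  have hd := euclNorm_nonneg (r - r')
  have habs := fun j => abs_le.1 (abs_le_euclNorm (r - r') j)
  refine (euclNorm_le_of_abs_le
    (b := euclNorm (r - r') / rmin a / m / (1 - B / (B + s2))) (by positivity)
    fun i => abs_le.2 ⟨?_, ?_⟩).trans_eq (by ring)
  · have := onesided r' hr' r hr _ hd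
      (fun j => by have := (habs j).1; simp only [Pi.sub_apply] at this; linarith) i
    simp only [Pi.sub_apply]
    linarith
  · exact onesided r hr r' hr' _ hd (fun j => (habs j).2) i
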